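/- Suppose z̄ ∈ Z_ad, p̄ ∈ L²(Ω), and λ̄ ∈ ∂ψ(z̄) satisfy the variational inequality (p̄ + σ z̄ + ν λ̄, z − z̄)_{L²} ≥ 0 for all z ∈ Z_ad. Then the sparsity characterization holds: for a.e. x ∈ Ω, z̄(x) = 0 if and only if |p̄(x)| ≤ ν. -/

import Mathlib

open MeasureTheory RealInnerProductSpace

/-- `ψ(z) = ‖z‖_{L¹(Ω)} = ∫_Ω |z| dμ`, the nondifferentiable part of the cost. -/
noncomputable def psi {Ω : Type*} [MeasurableSpace Ω] (μ : Measure Ω) (z : Lp ℝ 2 μ) : ℝ :=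
  ∫ x, |z x| ∂μ

/-- The admissible set `Z_ad = {z ∈ L²(Ω) : a ≤ z ≤ b a.e.}`. -/
def Zad {Ω : Type*} [MeasurableSpace Ω] (μ : Measure Ω) (a b : ℝ) : Set (Lp ℝ 2 μ) :=
  {z | ∀ᵐ x ∂μ, a ≤ z x ∧ z x ≤ b}

/-- `l` is a subgradient of `g` at `z`. -/
def IsSubgradient {Ω : Type*} [MeasurableSpace Ω] {μ : Measure Ω}
    (g : Lp ℝ 2 μ → ℝ) (z l : Lp ℝ 2 μ) : Prop :=
  ∀ w : Lp ℝ 2 μ, ⟪l, w - z⟫ ≤ g w - g z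

/-- The reduced cost functional `f(z) = ½‖Sz−u_d‖² + (σ/2)‖z‖² + ν ψ(z)`. -/
noncomputable def fcost {Ω : Type*} [MeasurableSpace Ω] {μ : Measure Ω}
    (S : Lp ℝ 2 μ →L[ℝ] Lp ℝ 2 μ) (ud : Lp ℝ 2 μ) (σ ν : ℝ) (z : Lp ℝ 2 μ) : ℝ :=
  (1 / 2) * ‖S z - ud‖ ^ 2 + (σ / 2) * ‖z‖ ^ 2 + ν * psi μ z

section Localization

variable {Ω : Type*} [MeasurableSpace Ω] {μ : Measure Ω}

theorem inner_sub_eq_setIntegral (g z w : Lp ℝ 2 μ) (c : ℝ) {s : Set Ω} (hs : MeasurableSet s)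
    (hws : ∀ᵐ x ∂μ, x ∈ s → w x = c) (hwz : ∀ᵐ x ∂μ, x ∉ s → w x = z x) :
    ⟪g, w - z⟫ = ∫ x in s, g x * (c - z x) ∂μ := by
  rw [L2.inner_def, ← integral_indicator hs]
  refine integral_congr_ae ?_
  filter_upwards [Lp.coeFn_sub w z, hws, hwz] with x hx h₁ h₂
  rw [hx, Pi.sub_apply]
  by_cases hxs : x ∈ s
  · simp [hxs, h₁ hxs, mul_comm]
  · simp [hxs, h₂ hxs]

variable [IsFiniteMeasure μ]

/-- The function equal to the constant `c` on `s` and to `z` off `s`, as an element of `L²`. -/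
theorem exists_Lp_eq_const_on (z : Lp ℝ 2 μ) (c : ℝ) {s : Set Ω} (hs : MeasurableSet s) :
    ∃ w : Lp ℝ 2 μ, (∀ᵐ x ∂μ, x ∈ s → w x = c) ∧ ∀ᵐ x ∂μ, x ∉ s → w x = z x := by
  classical
  have hw : MemLp (s.piecewise (fun _ => c) z) 2 μ :=
    MemLp.piecewise hs (memLp_const c) ((Lp.memLp z).restrict _)
  refine ⟨hw.toLp _, ?_, ?_⟩
  · filter_upwards [hw.coeFn_toLp] with x hx hxs
    rw [hx, Set.piecewise_eq_of_mem _ _ _ hxs]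
  · filter_upwards [hw.coeFn_toLp] with x hx hxs
    rw [hx, Set.piecewise_eq_of_notMem _ _ _ hxs]

theorem integrable_mul_const_sub (g z : Lp ℝ 2 μ) (c : ℝ) :
    Integrable (fun x => g x * (c - z x)) μ :=
  (Lp.memLp g).integrable_mul ((memLp_const c).sub (Lp.memLp z))

theorem integrable_abs_Lp (z : Lp ℝ 2 μ) : Integrable (fun x => |z x|) μ :=
  ((Lp.memLp z).integrable one_le_two).abs

theorem psi_sub_eq_setIntegral (z w : Lp ℝ 2 μ) (c : ℝ) {s : Set Ω} (hs : MeasurableSet s)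
    (hws : ∀ᵐ x ∂μ, x ∈ s → w x = c) (hwz : ∀ᵐ x ∂μ, x ∉ s → w x = z x) :
    psi μ w - psi μ z = ∫ x in s, (|c| - |z x|) ∂μ := by
  rw [psi, psi, ← integral_sub (integrable_abs_Lp w) (integrable_abs_Lp z),
    ← integral_indicator hs]
  refine integral_congr_ae ?_
  filter_upwards [hws, hwz] with x h₁ h₂
  by_cases hxs : x ∈ s
  · simp [hxs, h₁ hxs]
  · simp [hxs, h₂ hxs]

/-- A variational inequality over `Zad` localizes to a pointwise inequality. -/
theorem ae_nonneg_mul_of_variational_inequality {a b : ℝ} {g z : Lp ℝ 2 μ} (hz : z ∈ Zad μ a b)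
    (hVI : ∀ w ∈ Zad μ a b, 0 ≤ ⟪g, w - z⟫) {c : ℝ} (hc : a ≤ c ∧ c ≤ b) :
    ∀ᵐ x ∂μ, 0 ≤ g x * (c - z x) := by
  refine ae_nonneg_of_forall_setIntegral_nonneg (integrable_mul_const_sub g z c) fun s hs _ => ?_
  obtain ⟨w, hws, hwz⟩ := exists_Lp_eq_const_on z c hs
  rw [← inner_sub_eq_setIntegral g z w c hs hws hwz]
  refine hVI w ?_
  filter_upwards [hz, hws, hwz] with x hx h₁ h₂
  by_cases hxs : x ∈ s
  · rwa [h₁ hxs]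
  · rwa [h₂ hxs]

/-- The subgradient inequality for the `L¹` norm localizes to a pointwise inequality. -/
theorem IsSubgradient.ae_mul_le {z l : Lp ℝ 2 μ} (h : IsSubgradient (psi μ) z l) (c : ℝ) :
    ∀ᵐ x ∂μ, l x * (c - z x) ≤ |c| - |z x| := by
  refine ae_le_of_forall_setIntegral_le (integrable_mul_const_sub l z c)
    ((integrable_const |c|).sub (integrable_abs_Lp z)) fun s hs _ => ?_
  obtain ⟨w, hws, hwz⟩ := exists_Lp_eq_const_on z c hs
  have hw := h w
  rwa [inner_sub_eq_setIntegral l z w c hs hws hwz, psi_sub_eq_setIntegral z w c hs hws hwz] at hw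

end Localization

/-- Sparsity characterization: a.e., `z̄(x) = 0 ↔ |p̄(x)| ≤ ν`. -/
theorem sparsity_characterization {Ω : Type*} [MeasurableSpace Ω] (μ : Measure Ω)
    [IsFiniteMeasure μ] (a b : ℝ) (ha : a < 0) (hb : 0 < b) (σ ν : ℝ) (hσ : 0 < σ) (hν : 0 < ν)
    (zb pb lb : Lp ℝ 2 μ) (hzb : zb ∈ Zad μ a b) (hlb : IsSubgradient (psi μ) zb lb)
    (hVI : ∀ z ∈ Zad μ a b, 0 ≤ ⟪pb + σ • zb + ν • lb, z - zb⟫) :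
    ∀ᵐ x ∂μ, zb x = 0 ↔ |pb x| ≤ ν := by
  filter_upwards [ae_nonneg_mul_of_variational_inequality hzb hVI ⟨le_rfl, (ha.trans hb).le⟩,
    ae_nonneg_mul_of_variational_inequality hzb hVI ⟨ha.le, hb.le⟩,
    ae_nonneg_mul_of_variational_inequality hzb hVI ⟨(ha.trans hb).le, le_rfl⟩,
    hlb.ae_mul_le (-1), hlb.ae_mul_le 0, hlb.ae_mul_le 1,
    Lp.coeFn_add (pb + σ • zb) (ν • lb), Lp.coeFn_add pb (σ • zb),
    Lp.coeFn_smul σ zb, Lp.coeFn_smul ν lb] with x hva hv0 hvb hl₁ hl0 hl1 e₁ e₂ e₃ e₄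
  have hg : (pb + σ • zb + ν • lb : Lp ℝ 2 μ) x = pb x + σ * zb x + ν * lb x := by
    simp only [e₁, e₂, e₃, e₄, Pi.add_apply, Pi.smul_apply, smul_eq_mul]
  rw [hg] at hva hv0 hvb
  constructor
  · intro h0
    simp only [h0, mul_zero, add_zero, sub_zero, abs_zero, abs_neg, abs_one] at hva hvb hl₁ hl1
    have hle : pb x + ν * lb x ≤ 0 := by nlinarith
    have hge : 0 ≤ pb x + ν * lb x := by nlinarith
    rw [abs_le]
    constructor <;> nlinarith
  · intro hp
    rw [abs_le] at hp
    rw [abs_zero, zero_sub] at hl0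
    rcases lt_trichotomy (zb x) 0 with h | h | h
    · rw [abs_of_neg h] at hl0
      have hl : lb x ≤ -1 := by nlinarith
      have hneg : pb x + σ * zb x + ν * lb x < 0 := by
        nlinarith [mul_neg_of_pos_of_neg hσ h]
      nlinarith [mul_pos_of_neg_of_neg hneg h]
    · exact h
    · rw [abs_of_pos h] at hl0
      have hl : 1 ≤ lb x := by nlinarith
      have hpos : 0 < pb x + σ * zb x + ν * lb x := by
        nlinarith [mul_pos hσ h]
      nlinarith [mul_pos hpos h]
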